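/- Let M ≥ 1, t ∈ 𝒯_M, L ≥ 1, and let j, k be even nonnegative integers with j + k = 2L. For each n ∈ ℕ let r^{(n)} ∈ ℝ^j and s^{(n)} ∈ ℝ^k be such that the concatenated list (r^{(n)}_1, …, r^{(n)}_j, t_1, …, t_{2M}, s^{(n)}_1, …, s^{(n)}_k) is strictly increasing (an element of 𝒯_{M+L}), and suppose r^{(n)}_j → −∞ and s^{(n)}_1 → +∞ as n → ∞ (when j = 0, resp. k = 0, the corresponding block and hypothesis are omitted). Then liminf_{n→∞} sSup σ(B^{(M+L)}_{⟨r^{(n)}, t, s^{(n)}⟩}) ≥ sSup σ(B^{(M)}_t) and limsup_{n→∞} sInf σ(B^{(M+L)}_{⟨r^{(n)}, t, s^{(n)}⟩}) ≤ sInf σ(B^{(M)}_t). -/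

import Mathlib

open MeasureTheory Filter

noncomputable section

namespace QB

/-- Lebesgue measure on the positive half-line. -/
abbrev μp : Measure ℝ := volume.restrict (Set.Ioi (0:ℝ))

/-- The Hilbert space `L²((0,∞))`. -/
abbrev Hp : Type := Lp ℂ 2 μp

/-- The Hilbert space `L²(ℝ)`. -/
abbrev HL : Type := Lp ℂ 2 (volume : Measure ℝ)

/-- The defining properties of the operators: `S t` is multiplication by `e^{-i k² t}`,
`R` is the isometry "extend by zero and apply the inverse Fourier–Plancherel transform"
(characterised by its isometry property together with the integral formula on
integrable elements of `L²((0,∞))`, which determine it uniquely by continuity and density),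
and `Pm` is the orthogonal projection onto functions supported in `(-∞,0)`. -/
structure Setup (S : ℝ → Hp →L[ℂ] Hp) (R : Hp →L[ℂ] HL) (Pm : HL →L[ℂ] HL) : Prop where
  hS : ∀ (t : ℝ) (φ : Hp),
    (S t φ : ℝ → ℂ) =ᵐ[μp] fun k => Complex.exp (-Complex.I * (k:ℂ)^2 * (t:ℂ)) * φ k
  hR_isometry : ∀ φ : Hp, ‖R φ‖ = ‖φ‖
  hR : ∀ φ : Hp, Integrable (φ : ℝ → ℂ) μp →
    (R φ : ℝ → ℂ) =ᵐ[volume]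
      fun x => (((2 * Real.pi) ^ (-(1/2) : ℝ) : ℝ) : ℂ) *
        ∫ k in Set.Ioi (0:ℝ), Complex.exp (Complex.I * (x:ℂ) * (k:ℂ)) * φ k
  hPm : ∀ ψ : HL, (Pm ψ : ℝ → ℂ) =ᵐ[volume] Set.indicator (Set.Iio (0:ℝ)) (fun x => ψ x)

/-- The single backflow operator `B_{⟨t₁,t₂⟩} = S_{t₂}* R* Π⁻ R S_{t₂} − S_{t₁}* R* Π⁻ R S_{t₁}`. -/
def B1 (S : ℝ → Hp →L[ℂ] Hp) (R : Hp →L[ℂ] HL) (Pm : HL →L[ℂ] HL) (t₁ t₂ : ℝ) :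
    Hp →L[ℂ] Hp :=
  (ContinuousLinearMap.adjoint (S t₂)).comp ((ContinuousLinearMap.adjoint R).comp
    (Pm.comp (R.comp (S t₂))))
  - (ContinuousLinearMap.adjoint (S t₁)).comp ((ContinuousLinearMap.adjoint R).comp
    (Pm.comp (R.comp (S t₁))))

/-- The `M`-fold backflow operator `B^{(M)}_t = Σ_{j=1}^M B_{⟨t_{2j-1}, t_{2j}⟩}`
(zero-based indexing of the tuple `t`). -/
def BM (S : ℝ → Hp →L[ℂ] Hp) (R : Hp →L[ℂ] HL) (Pm : HL →L[ℂ] HL) (M : ℕ)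
    (t : Fin (2*M) → ℝ) : Hp →L[ℂ] Hp :=
  ∑ j : Fin M, B1 S R Pm (t ⟨2*j.1, by have := j.isLt; omega⟩)
    (t ⟨2*j.1+1, by have := j.isLt; omega⟩)

/-- `𝒯_M`: the set of strictly increasing `2M`-tuples of reals. -/
def TM (M : ℕ) : Set (Fin (2*M) → ℝ) := {t | StrictMono t}

/-- The concatenation `(r₁,…,r_j, t₁,…,t_{2M}, s₁,…,s_k)`, viewed as a `2(M+L)`-tuple
(using `j + k = 2L`). -/
def concat3 {j M k L : ℕ} (hjk : j + k = 2*L) (r : Fin j → ℝ) (t : Fin (2*M) → ℝ)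
    (s : Fin k → ℝ) : Fin (2*(M+L)) → ℝ := fun i =>
  if h1 : (i:ℕ) < j then r ⟨i, h1⟩
  else if h2 : (i:ℕ) < j + 2*M then t ⟨(i:ℕ) - j, by omega⟩
  else s ⟨(i:ℕ) - (j + 2*M), by have := i.isLt; omega⟩

open scoped Topology

section Spectrum

variable {E : Type*} [NormedAddCommGroup E] [InnerProductSpace ℂ E] [CompleteSpace E]

/-- A self-adjoint operator is bounded above by `c` iff its quadratic form is. -/
theorem le_algebraMap_iff_reApplyInnerSelf_le {A : E →L[ℂ] E} (hA : IsSelfAdjoint A) (c : ℝ) :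
    A ≤ algebraMap ℝ (E →L[ℂ] E) c ↔ ∀ φ, A.reApplyInnerSelf φ ≤ c * ‖φ‖ ^ 2 := by
  have hc : IsSelfAdjoint (algebraMap ℝ (E →L[ℂ] E) c) := .algebraMap _ (.all c)
  have hre (φ : E) : (algebraMap ℝ (E →L[ℂ] E) c - A).reApplyInnerSelf φ =
      c * ‖φ‖ ^ 2 - A.reApplyInnerSelf φ := by
    have h : (algebraMap ℝ (E →L[ℂ] E) c) φ = (c : ℂ) • φ := by
      simp [Algebra.algebraMap_eq_smul_one]
    simp only [ContinuousLinearMap.reApplyInnerSelf, sub_apply,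
      inner_sub_left, map_sub, h, inner_smul_left, Complex.conj_ofReal,
      inner_self_eq_norm_sq_to_K]
    simp [← Complex.ofReal_pow]
  rw [ContinuousLinearMap.le_def, ContinuousLinearMap.isPositive_def']
  simp [hre, hc.sub hA]

variable [Nontrivial E]

theorem sSup_spectrum_le_iff {A : E →L[ℂ] E} (hA : IsSelfAdjoint A) (c : ℝ) :
    sSup (spectrum ℝ A) ≤ c ↔ ∀ φ, A.reApplyInnerSelf φ ≤ c * ‖φ‖ ^ 2 := by
  rw [← le_algebraMap_iff_reApplyInnerSelf_le hA, le_algebraMap_iff_spectrum_le hA,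
    csSup_le_iff (spectrum.isCompact A).bddAbove
      (ContinuousFunctionalCalculus.spectrum_nonempty A hA)]

theorem abs_sSup_spectrum_le {A : E →L[ℂ] E} (hA : IsSelfAdjoint A) :
    |sSup (spectrum ℝ A)| ≤ ‖A‖ :=
  spectrum.norm_le_norm_of_mem (𝕜 := ℝ) <|
    (spectrum.isCompact A).sSup_mem (ContinuousFunctionalCalculus.spectrum_nonempty A hA)

variable {ι : Type*} {l : Filter ι} {A : ι → E →L[ℂ] E} {B : E →L[ℂ] E}

theorem eventually_lt_sSup_spectrum (hA : ∀ n, IsSelfAdjoint (A n)) (hB : IsSelfAdjoint B)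
    (h : ∀ φ, Tendsto (fun n => (A n).reApplyInnerSelf φ) l (𝓝 (B.reApplyInnerSelf φ)))
    {a : ℝ} (ha : a < sSup (spectrum ℝ B)) : ∀ᶠ n in l, a < sSup (spectrum ℝ (A n)) := by
  rw [← not_le, sSup_spectrum_le_iff hB] at ha
  push Not at ha
  obtain ⟨φ, hφ⟩ := ha
  filter_upwards [(h φ).eventually_const_lt hφ] with n hn
  rw [← not_le, sSup_spectrum_le_iff (hA n)]
  exact fun H => (H φ).not_gt hn

/-- The supremum of the spectrum is lower semicontinuous along weakly convergent, norm bounded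
families of self-adjoint operators. -/
theorem sSup_spectrum_le_liminf [l.NeBot] (hA : ∀ n, IsSelfAdjoint (A n)) (hB : IsSelfAdjoint B)
    (h : ∀ φ, Tendsto (fun n => (A n).reApplyInnerSelf φ) l (𝓝 (B.reApplyInnerSelf φ)))
    {C : ℝ} (hC : ∀ n, ‖A n‖ ≤ C) :
    sSup (spectrum ℝ B) ≤ liminf (fun n => sSup (spectrum ℝ (A n))) l := by
  refine le_of_forall_lt fun a ha => ?_
  obtain ⟨b, hab, hb⟩ := exists_between ha
  refine hab.trans_le (le_liminf_of_le ?_ ?_)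
  · exact IsBoundedUnder.isCoboundedUnder_ge
      ⟨C, eventually_map.2 <| .of_forall fun n =>
        (le_abs_self _).trans ((abs_sSup_spectrum_le (hA n)).trans (hC n))⟩
  · exact (eventually_lt_sSup_spectrum hA hB h hb).mono fun _ => le_of_lt

/-- The infimum of the spectrum is upper semicontinuous along weakly convergent, norm bounded
families of self-adjoint operators. -/
theorem limsup_sInf_spectrum_le [l.NeBot] (hA : ∀ n, IsSelfAdjoint (A n)) (hB : IsSelfAdjoint B)
    (h : ∀ φ, Tendsto (fun n => (A n).reApplyInnerSelf φ) l (𝓝 (B.reApplyInnerSelf φ)))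
    {C : ℝ} (hC : ∀ n, ‖A n‖ ≤ C) :
    limsup (fun n => sInf (spectrum ℝ (A n))) l ≤ sInf (spectrum ℝ B) := by
  have hneg (D : E →L[ℂ] E) : sInf (spectrum ℝ D) = -sSup (spectrum ℝ (-D)) := by
    rw [← spectrum.neg_eq, Real.sInf_def]
  have hre (D : E →L[ℂ] E) (φ : E) : (-D).reApplyInnerSelf φ = -D.reApplyInnerSelf φ := by
    simp [ContinuousLinearMap.reApplyInnerSelf]
  simp only [hneg]
  refine le_of_forall_gt fun a ha => ?_
  obtain ⟨b, hb, hab⟩ := exists_between ha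
  refine lt_of_le_of_lt (limsup_le_of_le ?_ ?_) hab
  · refine IsBoundedUnder.isCoboundedUnder_le
      ⟨-C, eventually_map.2 <| .of_forall fun n => neg_le_neg ?_⟩
    exact (le_abs_self _).trans ((abs_sSup_spectrum_le (hA n).neg).trans (norm_neg (A n) ▸ hC n))
  · have := eventually_lt_sSup_spectrum (fun n => (hA n).neg) hB.neg
      (fun φ => by simpa only [hre] using (h φ).neg) (neg_lt.1 hb)
    exact this.mono fun _ hn => (neg_lt.1 hn).le

end Spectrum

section Oscillatory

theorem abs_sub_two_mul {x t k : ℝ} (hk : 0 ≤ k) (hxt : x * t ≤ 0) :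
    |x - 2 * k * t| = |x| + 2 * k * |t| := by
  rcases mul_nonpos_iff.1 hxt with ⟨hx, ht⟩ | ⟨hx, ht⟩
  · rw [abs_of_nonneg hx, abs_of_nonpos ht, abs_of_nonneg (by nlinarith)]; ring
  · rw [abs_of_nonpos hx, abs_of_nonneg ht, abs_of_nonpos (by nlinarith)]; ring

/-- Non-stationary phase estimate for the free Schrödinger evolution of a wave packet supported
at positive momenta. -/
theorem exists_norm_integral_exp_mul_le {g : ℝ → ℂ} (hg : ContDiff ℝ 1 g) {a b : ℝ} (ha : 0 < a)
    (hab : a ≤ b) (hga : g a = 0) (hgb : g b = 0) :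
    ∃ C : ℝ, ∀ x t : ℝ, t ≠ 0 → x * t ≤ 0 →
      ‖∫ k in a..b, Complex.exp (Complex.I * (x * k - k ^ 2 * t)) * g k‖
        ≤ C / (|x| + 2 * a * |t|) := by
  have hg' : Continuous (deriv g) := hg.continuous_deriv le_rfl
  obtain ⟨C₀, hC₀⟩ := isCompact_Icc.exists_bound_of_continuousOn
    (s := Set.Icc a b) hg.continuous.continuousOn
  obtain ⟨C₁, hC₁⟩ := isCompact_Icc.exists_bound_of_continuousOn
    (s := Set.Icc a b) hg'.continuousOn
  refine ⟨(C₁ + C₀ / a) * |b - a|, fun x t ht hxt => ?_⟩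
  have ht' : 0 < |t| := abs_pos.2 ht
  set D := |x| + 2 * a * |t| with hD
  have hD0 : 0 < D := by positivity
  have hθ {k : ℝ} (hk : k ∈ Set.Icc a b) : D ≤ |x - 2 * k * t| := by
    rw [abs_sub_two_mul (ha.le.trans hk.1) hxt]
    nlinarith [hk.1]
  have hθt {k : ℝ} (hk : k ∈ Set.Icc a b) : 2 * a * |t| ≤ |x - 2 * k * t| := by
    linarith [hθ hk, abs_nonneg x]
  have hθ0 {k : ℝ} (hk : k ∈ Set.Icc a b) : ((x - 2 * k * t : ℝ) : ℂ) ≠ 0 :=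
    Complex.ofReal_ne_zero.2 <| abs_pos.1 <| hD0.trans_le (hθ hk)
  have hd (k : ℝ) : HasDerivAt (fun k : ℝ => ((x - 2 * k * t : ℝ) : ℂ)) ((-(2 * t) : ℝ) : ℂ) k := by
    refine HasDerivAt.ofReal_comp ?_
    simpa using ((((hasDerivAt_id k).const_mul 2).mul_const t).const_sub x)
  have hu (k : ℝ) (hk : k ∈ Set.uIcc a b) :
      HasDerivAt (fun k : ℝ => g k * ((x - 2 * k * t : ℝ) : ℂ)⁻¹)
        (deriv g k * ((x - 2 * k * t : ℝ) : ℂ)⁻¹ +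
          g k * (((2 * t : ℝ) : ℂ) / ((x - 2 * k * t : ℝ) : ℂ) ^ 2)) k := by
    rw [Set.uIcc_of_le hab] at hk
    have := ((hg.differentiable one_ne_zero) k).hasDerivAt.mul ((hd k).inv (hθ0 hk))
    refine this.congr_deriv ?_
    simp
  have hv (k : ℝ) (_ : k ∈ Set.uIcc a b) :
      HasDerivAt (fun k : ℝ => Complex.exp (Complex.I * (x * k - k ^ 2 * t)))
        (Complex.exp (Complex.I * (x * k - k ^ 2 * t)) *
          (Complex.I * ((x - 2 * k * t : ℝ) : ℂ))) k := by
    refine HasDerivAt.cexp ?_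
    have h1 : HasDerivAt (fun k : ℝ => (k : ℂ)) 1 k := (hasDerivAt_id k).ofReal_comp
    have := (((h1.const_mul (x : ℂ)).sub ((h1.pow 2).mul_const (t : ℂ))).const_mul Complex.I)
    exact this.congr_deriv (by simp)
  have hθc : Continuous (fun k : ℝ => ((x - 2 * k * t : ℝ) : ℂ)) := by fun_prop
  have hu' : IntervalIntegrable (fun k : ℝ => deriv g k * ((x - 2 * k * t : ℝ) : ℂ)⁻¹ +
          g k * (((2 * t : ℝ) : ℂ) / ((x - 2 * k * t : ℝ) : ℂ) ^ 2)) volume a b := by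
    refine ContinuousOn.intervalIntegrable ?_
    rw [Set.uIcc_of_le hab]
    refine (hg'.continuousOn.mul (hθc.continuousOn.inv₀ fun k hk => hθ0 hk)).add
      (hg.continuous.continuousOn.mul (continuousOn_const.div (hθc.pow 2).continuousOn
        fun k hk => pow_ne_zero 2 (hθ0 hk)))
  have hv' : IntervalIntegrable (fun k : ℝ => Complex.exp (Complex.I * (x * k - k ^ 2 * t)) *
          (Complex.I * ((x - 2 * k * t : ℝ) : ℂ))) volume a b :=
    Continuous.intervalIntegrable (by fun_prop) _ _
  have hparts := intervalIntegral.integral_mul_deriv_eq_deriv_mul hu hv hu' hv'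
  have hI : ∫ k in a..b, g k * ((x - 2 * k * t : ℝ) : ℂ)⁻¹ *
      (Complex.exp (Complex.I * (x * k - k ^ 2 * t)) * (Complex.I * ((x - 2 * k * t : ℝ) : ℂ))) =
      Complex.I * ∫ k in a..b, Complex.exp (Complex.I * (x * k - k ^ 2 * t)) * g k := by
    rw [← intervalIntegral.integral_const_mul]
    refine intervalIntegral.integral_congr fun k hk => ?_
    rw [Set.uIcc_of_le hab] at hk
    have := hθ0 hk
    field_simp
  rw [hI, hga, hgb] at hparts
  simp only [zero_mul, sub_zero, zero_sub] at hparts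
  have hnorm := congrArg norm hparts
  rw [norm_mul, Complex.norm_I, one_mul, norm_neg] at hnorm
  rw [hnorm, div_eq_mul_inv, mul_right_comm]
  refine intervalIntegral.norm_integral_le_of_norm_le_const fun k hk => ?_
  rw [Set.uIoc_of_le hab] at hk
  replace hk := Set.Ioc_subset_Icc_self hk
  have hexp : ‖Complex.exp (Complex.I * (x * k - k ^ 2 * t))‖ = 1 := by
    rw [mul_comm]; 
    rw [← Complex.norm_exp_ofReal_mul_I (x * k - k ^ 2 * t)]
    push_cast
    rfl
  have h0 := (norm_nonneg _).trans (hC₀ k hk)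
  have h1 := (norm_nonneg _).trans (hC₁ k hk)
  have hinv : |x - 2 * k * t|⁻¹ ≤ D⁻¹ := inv_anti₀ hD0 (hθ hk)
  have hpos : 0 < |x - 2 * k * t| := hD0.trans_le (hθ hk)
  rw [norm_mul, hexp, mul_one]
  refine (norm_add_le _ _).trans ?_
  rw [add_mul]
  refine add_le_add ?_ ?_
  · rw [norm_mul, norm_inv, Complex.norm_real, Real.norm_eq_abs]
    exact mul_le_mul (hC₁ k hk) hinv (by positivity) h1
  · rw [norm_mul, norm_div, norm_pow, Complex.norm_real, Complex.norm_real, Real.norm_eq_abs,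
      Real.norm_eq_abs, div_mul_eq_mul_div, mul_div_assoc]
    refine mul_le_mul (hC₀ k hk) ?_ (by positivity) h0
    rw [abs_mul, abs_two, div_le_div_iff₀ (by positivity) ha, sq]
    calc 2 * |t| * a = 2 * a * |t| := by ring
      _ ≤ |x - 2 * k * t| := hθt hk
      _ ≤ D⁻¹ * |x - 2 * k * t| * |x - 2 * k * t| := by
        refine le_mul_of_one_le_left hpos.le ?_
        rw [inv_mul_eq_div, one_le_div hD0]
        exact hθ hk
      _ = _ := by ring

end Oscillatory

theorem norm_sq_eq_integral {α : Type*} [MeasurableSpace α] {μ : Measure α} (f : Lp ℂ 2 μ) :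
    ‖f‖ ^ 2 = ∫ x, ‖f x‖ ^ 2 ∂μ := by
  have h : ∫ x, inner ℂ (f x) (f x) ∂μ = (‖f‖ : ℂ) ^ 2 := by
    rw [← L2.inner_def, inner_self_eq_norm_sq_to_K]
    rfl
  have hx (x : α) : inner ℂ (f x) (f x) = ((‖f x‖ ^ 2 : ℝ) : ℂ) := by
    rw [inner_self_eq_norm_sq_to_K, Complex.ofReal_pow]
    rfl
  simp only [hx] at h
  rw [integral_complex_ofReal] at h
  exact_mod_cast h.symm

theorem tendsto_zero_of_topologicalClosure_eq_top {ι E F : Type*} {l : Filter ι}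
    [NormedAddCommGroup E] [NormedSpace ℂ E] [NormedAddCommGroup F] [NormedSpace ℂ F]
    {T : ι → E →L[ℂ] F} (hT : ∀ i φ, ‖T i φ‖ ≤ ‖φ‖) {s : Set E}
    (hs : (Submodule.span ℂ s).topologicalClosure = ⊤)
    (h : ∀ φ ∈ s, Tendsto (fun i => T i φ) l (𝓝 0)) (φ : E) :
    Tendsto (fun i => T i φ) l (𝓝 0) := by
  have hspan (ψ : E) (hψ : ψ ∈ Submodule.span ℂ s) : Tendsto (fun i => T i ψ) l (𝓝 0) := by
    induction hψ using Submodule.span_induction with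
    | mem ψ hψ => exact h ψ hψ
    | zero => simpa only [map_zero] using tendsto_const_nhds
    | add ψ χ _ _ hψ hχ => simpa using hψ.add hχ
    | smul c ψ _ hψ => simpa using hψ.const_smul c
  rw [Metric.tendsto_nhds]
  intro ε hε
  obtain ⟨ψ, hψ, hψφ⟩ := Metric.dense_iff.1
    (Submodule.dense_iff_topologicalClosure_eq_top.2 hs) φ (ε / 2) (half_pos hε)
  filter_upwards [Metric.tendsto_nhds.1 (hspan ψ hψφ) (ε / 2) (half_pos hε)] with i hi
  rw [dist_zero_right] at hi ⊢
  rw [mem_ball_iff_norm'] at hψ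
  calc ‖T i φ‖ = ‖T i (φ - ψ) + T i ψ‖ := by rw [← map_add, sub_add_cancel]
    _ ≤ ‖φ - ψ‖ + ‖T i ψ‖ := (norm_add_le _ _).trans (by gcongr; exact hT i _)
    _ < ε := by linarith

/-- The `L²` classes of test functions supported in the open half-line. -/
def testFunctions : Set Hp :=
  {φ | ∃ g : ℝ → ℝ, ContDiff ℝ 1 g ∧ HasCompactSupport g ∧ tsupport g ⊆ Set.Ioi 0 ∧
    φ =ᵐ[μp] fun x => (g x : ℂ)}

theorem topologicalClosure_span_testFunctions :
    (Submodule.span ℂ testFunctions).topologicalClosure = ⊤ := by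
  rw [Submodule.topologicalClosure_eq_top_iff, Submodule.eq_bot_iff]
  intro φ hφ
  have hloc : LocallyIntegrableOn φ (Set.Ioi 0) μp :=
    ((Lp.memLp φ).locallyIntegrable one_le_two).locallyIntegrableOn _
  have hzero := isOpen_Ioi.ae_eq_zero_of_integral_contDiff_smul_eq_zero hloc
    fun g hg hgc hgs => by
      have hmem : MemLp (fun x => (g x : ℂ)) 2 μp :=
        (hg.continuous.memLp_of_hasCompactSupport hgc).ofReal
      have hinner := (Submodule.mem_orthogonal _ _).1 hφ (hmem.toLp _) <|
        Submodule.subset_span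
          ⟨g, hg.of_le (by exact_mod_cast le_top), hgc, hgs, hmem.coeFn_toLp⟩
      rw [L2.inner_def] at hinner
      rw [← hinner]
      refine integral_congr_ae ?_
      filter_upwards [hmem.coeFn_toLp] with x hx
      rw [hx]
      simp [mul_comm]
  rw [Lp.eq_zero_iff_ae_eq_zero]
  filter_upwards [hzero, ae_restrict_mem measurableSet_Ioi] with x hx hx0 using hx hx0

theorem exists_Icc_of_hasCompactSupport_of_tsupport_subset_Ioi {g : ℝ → ℝ}
    (hgc : HasCompactSupport g) (hgs : tsupport g ⊆ Set.Ioi 0) :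
    ∃ a b : ℝ, 0 < a ∧ a ≤ b ∧ ∀ x, x ∉ Set.Ioo a b → g x = 0 := by
  have hK : IsCompact (insert 1 (tsupport g)) := IsCompact.insert hgc 1
  obtain ⟨m, hm, hm'⟩ := hK.exists_isLeast (Set.insert_nonempty _ _)
  obtain ⟨M, hM, hM'⟩ := hK.exists_isGreatest (Set.insert_nonempty _ _)
  have hm0 : 0 < m := Set.insert_subset (Set.mem_Ioi.2 one_pos) hgs hm
  have hm1 : m ≤ M := hm' hM
  refine ⟨m / 2, M + 1, half_pos hm0, by linarith, fun x hx => ?_⟩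
  by_contra hgx
  have hxK : x ∈ insert 1 (tsupport g) := Or.inr (subset_tsupport g hgx)
  exact hx ⟨by linarith [hm' hxK], by linarith [hM' hxK]⟩

variable {S : ℝ → Hp →L[ℂ] Hp} {R : Hp →L[ℂ] HL} {Pm : HL →L[ℂ] HL}

namespace Setup

theorem norm_S (h : Setup S R Pm) (t : ℝ) (φ : Hp) : ‖S t φ‖ = ‖φ‖ := by
  have hnorm : ∀ᵐ k ∂μp, ‖S t φ k‖ = ‖φ k‖ := by
    filter_upwards [h.hS t φ] with k hk
    have : Complex.exp (-Complex.I * k ^ 2 * t) = Complex.exp ((-(k ^ 2 * t) : ℝ) * Complex.I) := by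
      push_cast; ring_nf
    rw [hk, norm_mul, this, Complex.norm_exp_ofReal_mul_I, one_mul]
  exact le_antisymm (Lp.norm_le_norm_of_ae_le (hnorm.mono fun _ => le_of_eq))
    (Lp.norm_le_norm_of_ae_le (hnorm.mono fun _ => ge_of_eq))

end Setup

theorem norm_le_of_coeFn_ae_eq_indicator {Q : HL →L[ℂ] HL} {A : Set ℝ}
    (hQ : ∀ ψ : HL, Q ψ =ᵐ[volume] A.indicator ψ) (ψ : HL) : ‖Q ψ‖ ≤ ‖ψ‖ := by
  refine Lp.norm_le_norm_of_ae_le ?_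
  filter_upwards [hQ ψ] with x hx
  rw [hx]
  exact norm_indicator_le_norm_self _ _

theorem isSelfAdjoint_of_coeFn_ae_eq_indicator {Q : HL →L[ℂ] HL} {A : Set ℝ}
    (hQ : ∀ ψ : HL, Q ψ =ᵐ[volume] A.indicator ψ) : IsSelfAdjoint Q := by
  rw [ContinuousLinearMap.isSelfAdjoint_iff_isSymmetric]
  intro ψ χ
  simp only [ContinuousLinearMap.coe_coe, L2.inner_def]
  refine integral_congr_ae ?_
  filter_upwards [hQ ψ, hQ χ] with x hx hx'
  rw [hx, hx']
  by_cases hxA : x ∈ A <;> simp [hxA]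

namespace Setup

theorem exists_norm_R_S_le (h : Setup S R Pm) {φ : Hp} (hφ : φ ∈ testFunctions) :
    ∃ a C : ℝ, 0 < a ∧ ∀ t : ℝ, t ≠ 0 → ∀ᵐ x : ℝ, x * t ≤ 0 →
      ‖R (S t φ) x‖ ≤ C / (|x| + 2 * a * |t|) := by
  obtain ⟨g, hg, hgc, hgs, hφg⟩ := hφ
  obtain ⟨a, b, ha, hab, hg0⟩ := exists_Icc_of_hasCompactSupport_of_tsupport_subset_Ioi hgc hgs
  have hgC : ContDiff ℝ 1 (fun k => (g k : ℂ)) := Complex.ofRealCLM.contDiff.comp hg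
  obtain ⟨C, hC⟩ := exists_norm_integral_exp_mul_le hgC ha hab
    (by simp [hg0 a]) (by simp [hg0 b])
  refine ⟨a, |(2 * Real.pi) ^ (-(1/2) : ℝ)| * C, ha, fun t ht => ?_⟩
  have hSφ : S t φ =ᵐ[μp] fun k => Complex.exp (-Complex.I * (k:ℂ)^2 * (t:ℂ)) * g k := by
    filter_upwards [h.hS t φ, hφg] with k hk hk'
    rw [hk, hk']
  have hint : Integrable (S t φ) μp := by
    refine Integrable.congr ?_ hSφ.symm
    refine (Continuous.integrable_of_hasCompactSupport (μ := volume) ?_ ?_).restrict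
    · exact .mul (by fun_prop) hgC.continuous
    · exact (hgc.comp_left (g := ((↑) : ℝ → ℂ)) Complex.ofReal_zero).mul_left
  filter_upwards [h.hR _ hint] with x hx hxt
  have hI : ∫ k in Set.Ioi (0:ℝ), Complex.exp (Complex.I * (x:ℂ) * (k:ℂ)) * S t φ k =
      ∫ k in a..b, Complex.exp (Complex.I * (x * k - k ^ 2 * t)) * g k := by
    rw [intervalIntegral.integral_of_le hab,
      ← setIntegral_eq_of_subset_of_forall_sdiff_eq_zero (s := Set.Ioc a b) (t := Set.Ioi 0)
        measurableSet_Ioi (fun k hk => ha.trans hk.1) (fun k hk => ?_)]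
    · refine integral_congr_ae ?_
      filter_upwards [hSφ] with k hk
      rw [hk, ← mul_assoc, ← Complex.exp_add]
      ring_nf
    · rw [hg0 k fun hk' => hk.2 (Set.Ioo_subset_Ioc_self hk')]
      simp
  rw [hx, hI, norm_mul, Complex.norm_real, Real.norm_eq_abs, mul_div_assoc]
  gcongr
  exact hC x t ht hxt

/-- A region swept by `x t ≤ 0` is asymptotically left by every wave packet. -/
theorem tendsto_cutoff_R_S (h : Setup S R Pm) {Q : HL →L[ℂ] HL} {A : Set ℝ}
    (hQ : ∀ ψ : HL, Q ψ =ᵐ[volume] A.indicator ψ) {l : Filter ℝ}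
    (hl : Tendsto (fun t => |t|) l atTop) (hA : ∀ᶠ t in l, ∀ x ∈ A, x * t ≤ 0) (φ : Hp) :
    Tendsto (fun t => Q (R (S t φ))) l (𝓝 0) := by
  refine tendsto_zero_of_topologicalClosure_eq_top (T := fun t => Q ∘L R ∘L S t) (fun t ψ => ?_)
    topologicalClosure_span_testFunctions (fun φ hφ => ?_) φ
  · exact (norm_le_of_coeFn_ae_eq_indicator hQ _).trans_eq
      ((h.hR_isometry _).trans (h.norm_S t ψ))
  obtain ⟨a, C, ha, hC⟩ := h.exists_norm_R_S_le hφ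
  rw [tendsto_zero_iff_norm_tendsto_zero]
  have hlim : Tendsto (fun t => C ^ 2 * Real.pi / (2 * a * |t|)) l (𝓝 0) :=
    Tendsto.const_div_atTop (hl.const_mul_atTop (by positivity)) _
  have hsq : Tendsto (fun t => ‖Q (R (S t φ))‖ ^ 2) l (𝓝 0) := by
    refine squeeze_zero' (.of_forall fun t => by positivity) ?_ hlim
    filter_upwards [hA, hl.eventually_gt_atTop 0] with t htA ht
    have ht0 : t ≠ 0 := abs_pos.1 ht
    set τ := 2 * a * |t| with hτ
    have hτ0 : 0 < τ := by positivity
    have hbound : (fun x => ‖Q (R (S t φ)) x‖ ^ 2) ≤ᵐ[volume]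
        fun x => C ^ 2 / τ ^ 2 * (1 + (x / τ) ^ 2)⁻¹ := by
      filter_upwards [hQ (R (S t φ)), hC t ht0] with x hx hx'
      rw [hx]
      by_cases hxA : x ∈ A
      · rw [Set.indicator_of_mem hxA]
        calc ‖R (S t φ) x‖ ^ 2 ≤ (C / (|x| + τ)) ^ 2 := by
              gcongr
              exact hx' (htA x hxA)
          _ = C ^ 2 / (|x| + τ) ^ 2 := div_pow _ _ _
          _ ≤ C ^ 2 / (τ ^ 2 * (1 + (x / τ) ^ 2)) := by
              gcongr
              have : τ ^ 2 * (1 + (x / τ) ^ 2) = τ ^ 2 + |x| ^ 2 := by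
                rw [sq_abs]; field_simp
              rw [this]
              nlinarith [abs_nonneg x]
          _ = _ := by rw [← div_div, div_eq_mul_inv]
      · rw [Set.indicator_of_notMem hxA]
        simp only [norm_zero, ne_eq, OfNat.ofNat_ne_zero, not_false_eq_true, zero_pow]
        positivity
    rw [norm_sq_eq_integral]
    refine (integral_mono_of_nonneg (.of_forall fun x => by positivity)
      ((integrable_inv_one_add_sq.comp_div hτ0.ne').const_mul _) hbound).trans_eq ?_
    rw [integral_const_mul, Measure.integral_comp_div (fun x => (1 + x ^ 2)⁻¹),
      integral_univ_inv_one_add_sq, abs_of_pos hτ0, smul_eq_mul]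
    field_simp
  simpa using hsq.sqrt

end Setup

/-- The operator of finding the particle on the negative half-line at time `t`. -/
def leftOp (S : ℝ → Hp →L[ℂ] Hp) (R : Hp →L[ℂ] HL) (Pm : HL →L[ℂ] HL) (t : ℝ) : Hp →L[ℂ] Hp :=
  (ContinuousLinearMap.adjoint (S t)).comp ((ContinuousLinearMap.adjoint R).comp
    (Pm.comp (R.comp (S t))))

theorem B1_eq_leftOp_sub (t₁ t₂ : ℝ) :
    B1 S R Pm t₁ t₂ = leftOp S R Pm t₂ - leftOp S R Pm t₁ := rfl

theorem reApplyInnerSelf_leftOp (t : ℝ) (φ : Hp) :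
    (leftOp S R Pm t).reApplyInnerSelf φ = RCLike.re (inner ℂ (Pm (R (S t φ))) (R (S t φ))) := by
  simp [leftOp, ContinuousLinearMap.reApplyInnerSelf, ContinuousLinearMap.adjoint_inner_left]

theorem reApplyInnerSelf_B1 (t₁ t₂ : ℝ) (φ : Hp) :
    (B1 S R Pm t₁ t₂).reApplyInnerSelf φ =
      (leftOp S R Pm t₂).reApplyInnerSelf φ - (leftOp S R Pm t₁).reApplyInnerSelf φ := by
  simp [B1_eq_leftOp_sub, ContinuousLinearMap.reApplyInnerSelf, inner_sub_left]

theorem reApplyInnerSelf_BM {M : ℕ} (t : Fin (2*M) → ℝ) (φ : Hp) :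
    (BM S R Pm M t).reApplyInnerSelf φ =
      ∑ j : Fin M, (B1 S R Pm (t ⟨2*j.1, by omega⟩)
        (t ⟨2*j.1+1, by omega⟩)).reApplyInnerSelf φ := by
  simp [BM, ContinuousLinearMap.reApplyInnerSelf, sum_inner]

instance : Nontrivial Hp := by
  have hμ : μp (Set.Ioc 0 1) = 1 := by
    rw [Measure.restrict_apply measurableSet_Ioc,
      Set.inter_eq_left.2 Set.Ioc_subset_Ioi_self]
    simp
  refine nontrivial_of_ne
    (indicatorConstLp 2 (measurableSet_Ioc (a := 0) (b := 1)) (by simp [hμ]) (1 : ℂ)) 0 ?_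
  rw [← norm_ne_zero_iff, norm_indicatorConstLp two_ne_zero ENNReal.ofNat_ne_top,
    measureReal_def, hμ]
  simp

namespace Setup

theorem isSelfAdjoint_leftOp (h : Setup S R Pm) (t : ℝ) : IsSelfAdjoint (leftOp S R Pm t) :=
  ((isSelfAdjoint_of_coeFn_ae_eq_indicator h.hPm).adjoint_conj R).adjoint_conj (S t)

theorem isSelfAdjoint_BM (h : Setup S R Pm) {M : ℕ} (t : Fin (2*M) → ℝ) :
    IsSelfAdjoint (BM S R Pm M t) :=
  isSelfAdjoint_sum _ fun _ _ => (h.isSelfAdjoint_leftOp _).sub (h.isSelfAdjoint_leftOp _)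

theorem norm_leftOp_le (h : Setup S R Pm) (t : ℝ) : ‖leftOp S R Pm t‖ ≤ 1 := by
  have hS : ‖S t‖ ≤ 1 :=
    (S t).opNorm_le_bound zero_le_one fun φ => by rw [h.norm_S, one_mul]
  have hR : ‖R‖ ≤ 1 := R.opNorm_le_bound zero_le_one fun φ => by rw [h.hR_isometry, one_mul]
  refine ContinuousLinearMap.opNorm_le_bound _ zero_le_one fun φ => ?_
  calc ‖leftOp S R Pm t φ‖
      ≤ ‖ContinuousLinearMap.adjoint R (Pm (R (S t φ)))‖ := by
        refine ((ContinuousLinearMap.adjoint (S t)).le_of_opNorm_le ?_ _).trans_eq (one_mul _)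
        rwa [LinearIsometryEquiv.norm_map]
    _ ≤ ‖Pm (R (S t φ))‖ := by
        refine (ContinuousLinearMap.le_of_opNorm_le _ ?_ _).trans_eq (one_mul _)
        rwa [LinearIsometryEquiv.norm_map]
    _ ≤ ‖R (S t φ)‖ := norm_le_of_coeFn_ae_eq_indicator h.hPm _
    _ = 1 * ‖φ‖ := by rw [h.hR_isometry, h.norm_S, one_mul]

theorem norm_BM_le (h : Setup S R Pm) {M : ℕ} (t : Fin (2*M) → ℝ) :
    ‖BM S R Pm M t‖ ≤ M * 2 := by
  refine (norm_sum_le_of_le (n := fun _ => 2) _ fun j _ => ?_).trans_eq (by simp)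
  rw [B1_eq_leftOp_sub]
  linarith [norm_sub_le (leftOp S R Pm (t ⟨2*j.1+1, by omega⟩))
    (leftOp S R Pm (t ⟨2*j.1, by omega⟩)), h.norm_leftOp_le (t ⟨2*j.1+1, by omega⟩),
    h.norm_leftOp_le (t ⟨2*j.1, by omega⟩)]

theorem tendsto_inner_cutoff_R_S (h : Setup S R Pm) {Q : HL →L[ℂ] HL} {A : Set ℝ}
    (hQ : ∀ ψ : HL, Q ψ =ᵐ[volume] A.indicator ψ) {l : Filter ℝ}
    (hl : Tendsto (fun t => |t|) l atTop) (hA : ∀ᶠ t in l, ∀ x ∈ A, x * t ≤ 0) (φ : Hp) :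
    Tendsto (fun t => RCLike.re (inner ℂ (Q (R (S t φ))) (R (S t φ)))) l (𝓝 0) := by
  have hlim : Tendsto (fun t => ‖Q (R (S t φ))‖ * ‖φ‖) l (𝓝 0) := by
    simpa using (h.tendsto_cutoff_R_S hQ hl hA φ).norm.mul_const ‖φ‖
  refine squeeze_zero_norm (fun t => ?_) hlim
  calc ‖RCLike.re (inner ℂ (Q (R (S t φ))) (R (S t φ)))‖
      ≤ ‖inner ℂ (Q (R (S t φ))) (R (S t φ))‖ := RCLike.abs_re_le_norm _
    _ ≤ ‖Q (R (S t φ))‖ * ‖R (S t φ)‖ := norm_inner_le_norm _ _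
    _ = ‖Q (R (S t φ))‖ * ‖φ‖ := by rw [h.hR_isometry, h.norm_S]

theorem tendsto_leftOp_atTop (h : Setup S R Pm) (φ : Hp) :
    Tendsto (fun t => (leftOp S R Pm t).reApplyInnerSelf φ) atTop (𝓝 0) := by
  simp only [reApplyInnerSelf_leftOp]
  refine h.tendsto_inner_cutoff_R_S h.hPm tendsto_abs_atTop_atTop ?_ φ
  filter_upwards [eventually_ge_atTop 0] with t ht x hx
  exact mul_nonpos_of_nonpos_of_nonneg (Set.mem_Iio.1 hx).le ht

theorem tendsto_leftOp_atBot (h : Setup S R Pm) (φ : Hp) :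
    Tendsto (fun t => (leftOp S R Pm t).reApplyInnerSelf φ) atBot (𝓝 (‖φ‖ ^ 2)) := by
  have hQ (ψ : HL) : (ContinuousLinearMap.id ℂ HL - Pm) ψ =ᵐ[volume]
      (Set.Ici 0).indicator ψ := by
    rw [sub_apply, ContinuousLinearMap.id_apply]
    filter_upwards [Lp.coeFn_sub ψ (Pm ψ), h.hPm ψ] with x hx hx'
    rw [hx, Pi.sub_apply, hx', ← Set.compl_Iio, Set.indicator_compl]
    rfl
  have hlim := h.tendsto_inner_cutoff_R_S hQ tendsto_abs_atBot_atTop (φ := φ) <| by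
    filter_upwards [eventually_le_atBot 0] with t ht x hx
    exact mul_nonpos_of_nonneg_of_nonpos hx ht
  have heq (t : ℝ) : (leftOp S R Pm t).reApplyInnerSelf φ = ‖φ‖ ^ 2 - RCLike.re
      (inner ℂ ((ContinuousLinearMap.id ℂ HL - Pm) (R (S t φ))) (R (S t φ))) := by
    rw [reApplyInnerSelf_leftOp, sub_apply, ContinuousLinearMap.id_apply, inner_sub_left, map_sub,
      inner_self_eq_norm_sq, h.hR_isometry, h.norm_S, sub_sub_cancel]
  simpa only [heq, sub_zero] using hlim.const_sub (‖φ‖ ^ 2)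

theorem tendsto_B1_atTop (h : Setup S R Pm) {u v : ℕ → ℝ} (hu : Tendsto u atTop atTop)
    (hv : Tendsto v atTop atTop) (φ : Hp) :
    Tendsto (fun n => (B1 S R Pm (u n) (v n)).reApplyInnerSelf φ) atTop (𝓝 0) := by
  simp only [reApplyInnerSelf_B1]
  simpa using ((h.tendsto_leftOp_atTop φ).comp hv).sub ((h.tendsto_leftOp_atTop φ).comp hu)

theorem tendsto_B1_atBot (h : Setup S R Pm) {u v : ℕ → ℝ} (hu : Tendsto u atTop atBot)
    (hv : Tendsto v atTop atBot) (φ : Hp) :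
    Tendsto (fun n => (B1 S R Pm (u n) (v n)).reApplyInnerSelf φ) atTop (𝓝 0) := by
  simp only [reApplyInnerSelf_B1]
  simpa using ((h.tendsto_leftOp_atBot φ).comp hv).sub ((h.tendsto_leftOp_atBot φ).comp hu)

end Setup

section Padding

variable {j M k L : ℕ} (hjk : j + k = 2*L) {t : Fin (2*M) → ℝ}

theorem concat3_apply_add (r : Fin j → ℝ) (s : Fin k → ℝ) {i : ℕ} (hi : i < 2*M) :
    concat3 hjk r t s ⟨j + i, by omega⟩ = t ⟨i, hi⟩ := by
  simp [concat3, hi]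

variable {r : ℕ → Fin j → ℝ} {s : ℕ → Fin k → ℝ}

theorem tendsto_concat3_atBot (hmono : ∀ n, StrictMono (concat3 hjk (r n) t (s n)))
    (hrlim : ∀ h0 : 0 < j, Tendsto (fun n : ℕ => r n ⟨j - 1, by omega⟩) atTop atBot)
    (i : Fin (2*(M+L))) (hi : i.1 < j) :
    Tendsto (fun n => concat3 hjk (r n) t (s n) i) atTop atBot := by
  refine tendsto_atBot_mono (fun n => ?_) (hrlim (by omega))
  have hlast : concat3 hjk (r n) t (s n) ⟨j - 1, by omega⟩ = r n ⟨j - 1, by omega⟩ :=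
    dif_pos (by simp; omega)
  rw [← hlast]
  exact (hmono n).monotone (Fin.le_def.2 (by simp; omega))

theorem tendsto_concat3_atTop (hmono : ∀ n, StrictMono (concat3 hjk (r n) t (s n)))
    (hslim : ∀ h0 : 0 < k, Tendsto (fun n : ℕ => s n ⟨0, h0⟩) atTop atTop)
    (i : Fin (2*(M+L))) (hi : j + 2*M ≤ i.1) :
    Tendsto (fun n => concat3 hjk (r n) t (s n) i) atTop atTop := by
  refine tendsto_atTop_mono (fun n => ?_) (hslim (by omega))
  have hfirst : concat3 hjk (r n) t (s n) ⟨j + 2*M, by omega⟩ = s n ⟨0, by omega⟩ := by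
    simp [concat3]
  rw [← hfirst]
  exact (hmono n).monotone (Fin.le_def.2 hi)

theorem Setup.tendsto_reApplyInnerSelf_BM_concat3 {S : ℝ → Hp →L[ℂ] Hp} {R : Hp →L[ℂ] HL}
    {Pm : HL →L[ℂ] HL} (h : Setup S R Pm) (hj : Even j)
    (hmono : ∀ n, StrictMono (concat3 hjk (r n) t (s n)))
    (hrlim : ∀ h0 : 0 < j, Tendsto (fun n : ℕ => r n ⟨j - 1, by omega⟩) atTop atBot)
    (hslim : ∀ h0 : 0 < k, Tendsto (fun n : ℕ => s n ⟨0, h0⟩) atTop atTop) (φ : Hp) :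
    Tendsto (fun n => (BM S R Pm (M+L) (concat3 hjk (r n) t (s n))).reApplyInnerSelf φ) atTop
      (𝓝 ((BM S R Pm M t).reApplyInnerSelf φ)) := by
  obtain ⟨p, hp⟩ := hj
  set b : Fin M → ℝ := fun i =>
    (B1 S R Pm (t ⟨2*i.1, by omega⟩) (t ⟨2*i.1+1, by omega⟩)).reApplyInnerSelf φ with hb
  set c : Fin (M+L) → ℝ := fun i =>
    if hi : p ≤ i.1 ∧ i.1 < p + M then b ⟨i.1 - p, by omega⟩ else 0 with hc
  have hsum : (BM S R Pm M t).reApplyInnerSelf φ = ∑ i, c i := by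
    rw [reApplyInnerSelf_BM]
    refine Finset.sum_of_injOn (fun i : Fin M => (⟨p + i.1, by omega⟩ : Fin (M+L))) ?_
      (fun _ _ => Finset.mem_coe.2 (Finset.mem_univ _)) ?_ ?_
    · intro i _ i' _ hii'
      simpa [Fin.ext_iff] using hii'
    · intro i _ hi
      refine dif_neg fun hpi => hi ⟨⟨i.1 - p, by omega⟩, by simp, Fin.ext ?_⟩
      simp; omega
    · intro i _
      simp [hc, hb]
  rw [hsum]
  simp only [reApplyInnerSelf_BM]
  refine tendsto_finsetSum _ fun i _ => ?_
  by_cases hi : p ≤ i.1 ∧ i.1 < p + M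
  · rw [show c i = _ from dif_pos hi]
    refine tendsto_const_nhds.congr fun n => ?_
    have h0 : (⟨2*i.1, by omega⟩ : Fin (2*(M+L))) = ⟨j + 2*(i.1-p), by omega⟩ :=
      Fin.ext (by simp; omega)
    have h1 : (⟨2*i.1+1, by omega⟩ : Fin (2*(M+L))) = ⟨j + (2*(i.1-p)+1), by omega⟩ :=
      Fin.ext (by simp; omega)
    rw [h0, h1, concat3_apply_add hjk _ _ (by omega), concat3_apply_add hjk _ _ (by omega)]
  · rw [show c i = 0 from dif_neg hi]
    rcases lt_or_ge i.1 p with hip | hip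
    · exact h.tendsto_B1_atBot (tendsto_concat3_atBot hjk hmono hrlim _ (by simp; omega))
        (tendsto_concat3_atBot hjk hmono hrlim _ (by simp; omega)) φ
    · exact h.tendsto_B1_atTop (tendsto_concat3_atTop hjk hmono hslim _ (by simp; omega))
        (tendsto_concat3_atTop hjk hmono hslim _ (by simp; omega)) φ

end Padding

/-- padding with `j` extra times going to `−∞` and `k` extra times going to `+∞`
(`j, k` even, `j + k = 2L`), one has
`liminf sSup σ(B^{(M+L)}) ≥ sSup σ(B^{(M)}_t)` and `limsup sInf σ(B^{(M+L)}) ≤ sInf σ(B^{(M)}_t)`. -/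
theorem backflow_padding_even
    (S : ℝ → Hp →L[ℂ] Hp) (R : Hp →L[ℂ] HL) (Pm : HL →L[ℂ] HL)
    (hSetup : Setup S R Pm)
    (M L j k : ℕ) (hM : 1 ≤ M) (hL : 1 ≤ L)
    (hj : Even j) (hk : Even k) (hjk : j + k = 2*L)
    (t : Fin (2*M) → ℝ) (ht : StrictMono t)
    (r : ℕ → Fin j → ℝ) (s : ℕ → Fin k → ℝ)
    (hmono : ∀ n : ℕ, StrictMono (concat3 hjk (r n) t (s n)))
    (hrlim : ∀ h0 : 0 < j,
      Tendsto (fun n : ℕ => r n ⟨j - 1, by omega⟩) atTop atBot)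
    (hslim : ∀ h0 : 0 < k,
      Tendsto (fun n : ℕ => s n ⟨0, h0⟩) atTop atTop) :
    sSup (spectrum ℝ (BM S R Pm M t)) ≤
      liminf (fun n : ℕ =>
        sSup (spectrum ℝ (BM S R Pm (M+L) (concat3 hjk (r n) t (s n))))) atTop ∧
    limsup (fun n : ℕ =>
        sInf (spectrum ℝ (BM S R Pm (M+L) (concat3 hjk (r n) t (s n))))) atTop ≤
      sInf (spectrum ℝ (BM S R Pm M t)) := by
  have hlim := hSetup.tendsto_reApplyInnerSelf_BM_concat3 hjk hj hmono hrlim hslim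
  have hA := fun n => hSetup.isSelfAdjoint_BM (concat3 hjk (r n) t (s n))
  have hB := hSetup.isSelfAdjoint_BM t
  have hC := fun n => hSetup.norm_BM_le (concat3 hjk (r n) t (s n))
  exact ⟨sSup_spectrum_le_liminf hA hB hlim hC, limsup_sInf_spectrum_le hA hB hlim hC⟩

end QB
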